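/- arXiv:2210.05645 — 9 statements merged into one kernel-verified Lean document; each statement's English description precedes it below -/
import Mathlib

section
/- Let ζ̄ > 0. Suppose ρ, θ : [0,ζ̄] → ℝ are twice continuously differentiable, ρ(ζ) > 0 for all ζ ∈ [0,ζ̄), the polar profile equations ρ''(ζ) + (2/ζ)ρ'(ζ) = ρ(ζ)(θ'(ζ)² + aζθ'(ζ) + 1 − ρ(ζ)²) and θ''(ζ) + (2/ζ)θ'(ζ) + 2(ρ'(ζ)/ρ(ζ))θ'(ζ) = −a(ρ(ζ) + ζρ'(ζ))/ρ(ζ) hold for all ζ ∈ (0,ζ̄), the initial conditions ρ(0) = ρ₀ > 0, ρ'(0) = 0, θ(0) = 0, θ'(0) = 0 hold, and there exists M > 0 with ζρ(ζ)|θ'(ζ)| ≤ M for all ζ ∈ [0,ζ̄). Then ρ(ζ̄) > 0. -/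
open MeasureTheory Filter Set

theorem stmt_3 (a ρ₀ ζbar : ℝ) (ha : 0 < a) (hρ₀ : 0 < ρ₀) (hζbar : 0 < ζbar)
    (ρ ρ' ρ'' θ θ' θ'' : ℝ → ℝ)
    (hdρ : ∀ ζ ∈ Set.Icc 0 ζbar, HasDerivAt ρ (ρ' ζ) ζ)
    (hdρ' : ∀ ζ ∈ Set.Icc 0 ζbar, HasDerivAt ρ' (ρ'' ζ) ζ)
    (hdθ : ∀ ζ ∈ Set.Icc 0 ζbar, HasDerivAt θ (θ' ζ) ζ)
    (hdθ' : ∀ ζ ∈ Set.Icc 0 ζbar, HasDerivAt θ' (θ'' ζ) ζ)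
    (hcρ : ContinuousOn ρ'' (Set.Icc 0 ζbar))
    (hcθ : ContinuousOn θ'' (Set.Icc 0 ζbar))
    (hpos : ∀ ζ ∈ Set.Ico 0 ζbar, 0 < ρ ζ)
    (hode1 : ∀ ζ ∈ Set.Ioo 0 ζbar, ρ'' ζ + (2/ζ) * ρ' ζ
        = ρ ζ * ((θ' ζ)^2 + a * ζ * θ' ζ + 1 - (ρ ζ)^2))
    (hode2 : ∀ ζ ∈ Set.Ioo 0 ζbar, θ'' ζ + (2/ζ) * θ' ζ + 2 * (ρ' ζ / ρ ζ) * θ' ζ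
        = -a * (ρ ζ + ζ * ρ' ζ) / ρ ζ)
    (hinit0 : ρ 0 = ρ₀) (hinit1 : ρ' 0 = 0) (hinit2 : θ 0 = 0) (hinit3 : θ' 0 = 0)
    (hbound : ∃ M > 0, ∀ ζ ∈ Set.Ico 0 ζbar, ζ * ρ ζ * |θ' ζ| ≤ M) :
    0 < ρ ζbar := by
  have hmem : ζbar ∈ Set.Icc 0 ζbar := ⟨hζbar.le, le_rfl⟩
  have hge : 0 ≤ ρ ζbar := by
    have hc : Tendsto ρ (nhdsWithin ζbar (Set.Iio ζbar)) (nhds (ρ ζbar)) :=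
      (hdρ ζbar hmem).continuousAt.tendsto.mono_left nhdsWithin_le_nhds
    refine ge_of_tendsto hc ?_
    filter_upwards [Ico_mem_nhdsLT hζbar] with x hx
    exact (hpos x hx).le
  rcases hge.lt_or_eq with h | h
  · exact h
  exfalso
  have hF : ∀ x ∈ Set.Icc 0 ζbar, HasDerivAt
      (fun x => x^2 * (ρ x)^2 * θ' x + a / 2 * (x^3 * (ρ x)^2))
      ((2 * x * (ρ x)^2 + x^2 * (2 * ρ x * ρ' x)) * θ' x + x^2 * (ρ x)^2 * θ'' x
        + a / 2 * (3 * x^2 * (ρ x)^2 + x^3 * (2 * ρ x * ρ' x))) x := by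
    intro x hx
    have h2 : HasDerivAt (fun x => (ρ x)^2) (2 * ρ x * ρ' x) x := by
      simpa using (hdρ x hx).fun_pow 2
    have h3 : HasDerivAt (fun x : ℝ => x^2) (2 * x) x := by simpa using hasDerivAt_pow 2 x
    have h4 : HasDerivAt (fun x : ℝ => x^3) (3 * x^2) x := by simpa using hasDerivAt_pow 3 x
    exact ((h3.fun_mul h2).fun_mul (hdθ' x hx)).fun_add ((h4.fun_mul h2).const_mul (a/2))
  obtain ⟨c, hc, hce⟩ := exists_hasDerivAt_eq_zero hζbar
    (fun x hx => (hF x hx).continuousAt.continuousWithinAt)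
    (by simp [← h]) (fun x hx => hF x ⟨hx.1.le, hx.2.le⟩)
  have hp := hpos c ⟨hc.1.le, hc.2⟩
  have hc0 : 0 < c := hc.1
  have h2 := hode2 c hc
  have key : 0 < a / 2 * (c^2 * (ρ c)^2) := by positivity
  field_simp at h2
  have h5 : (2 * c * (ρ c)^2 + c^2 * (2 * ρ c * ρ' c)) * θ' c + c^2 * (ρ c)^2 * θ'' c
      = -a * (ρ c + c * ρ' c) * c^2 * ρ c := by
    linear_combination (c * ρ c) * h2
  nlinarith
end

section
/- For all ζ ≥ 0, the solution satisfies the integral identity ζ²ρ(ζ)²(θ'(ζ) + aζ/2) = (a/2)∫₀^ζ (tρ(t))² dt. -/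
open MeasureTheory Filter Set

theorem stmt_4 (a ρ₀ : ℝ) (ha : 0 < a) (hρ₀ : 0 < ρ₀)
    (ρ ρ' ρ'' θ θ' θ'' : ℝ → ℝ)
    (hdρ : ∀ ζ ≥ (0:ℝ), HasDerivAt ρ (ρ' ζ) ζ)
    (hdρ' : ∀ ζ ≥ (0:ℝ), HasDerivAt ρ' (ρ'' ζ) ζ)
    (hdθ : ∀ ζ ≥ (0:ℝ), HasDerivAt θ (θ' ζ) ζ)
    (hdθ' : ∀ ζ ≥ (0:ℝ), HasDerivAt θ' (θ'' ζ) ζ)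
    (hcρ : ContinuousOn ρ'' (Set.Ici 0))
    (hcθ : ContinuousOn θ'' (Set.Ici 0))
    (hpos : ∀ ζ ≥ (0:ℝ), 0 < ρ ζ)
    (hode1 : ∀ ζ > (0:ℝ), ρ'' ζ + (2/ζ) * ρ' ζ
        = ρ ζ * ((θ' ζ)^2 + a * ζ * θ' ζ + 1 - (ρ ζ)^2))
    (hode2 : ∀ ζ > (0:ℝ), θ'' ζ + (2/ζ) * θ' ζ + 2 * (ρ' ζ / ρ ζ) * θ' ζ
        = -a * (ρ ζ + ζ * ρ' ζ) / ρ ζ)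
    (hinit0 : ρ 0 = ρ₀) (hinit1 : ρ' 0 = 0) (hinit2 : θ 0 = 0) (hinit3 : θ' 0 = 0)
    :
    ∀ ζ ≥ (0:ℝ), ζ^2 * (ρ ζ)^2 * (θ' ζ + a * ζ / 2)
      = (a/2) * ∫ t in (0:ℝ)..ζ, (t * ρ t)^2 := by
  intro ζ hζ
  have key : ∀ t ∈ Set.uIcc (0:ℝ) ζ,
      HasDerivAt (fun x : ℝ => x^2 * (ρ x)^2 * (θ' x + a * x / 2)) (a/2 * (t * ρ t)^2) t := by
    intro t ht
    rw [Set.uIcc_of_le hζ] at ht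
    have ht0 : 0 ≤ t := ht.1
    have h1 := ((((hasDerivAt_id t).pow 2).mul ((hdρ t ht0).pow 2)).mul
      ((hdθ' t ht0).add (((hasDerivAt_id t).const_mul a).div_const 2)))
    refine h1.congr_deriv ?_
    simp only [id, Pi.pow_apply, Pi.mul_apply, Pi.add_apply]
    rcases ht0.eq_or_lt with h | h
    · subst h
      simp
    · have hp := (hpos t ht0).ne'
      have e := hode2 t h
      have ht' := h.ne'
      field_simp at e
      push_cast
      norm_num
      linear_combination t * ρ t * e
  have hcont : ContinuousOn (fun t => a/2 * (t * ρ t)^2) (Set.uIcc (0:ℝ) ζ) := by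
    have hρ : ContinuousOn ρ (Set.uIcc (0:ℝ) ζ) := by
      intro t ht
      rw [Set.uIcc_of_le hζ] at ht
      exact (hdρ t ht.1).continuousAt.continuousWithinAt
    fun_prop
  have := intervalIntegral.integral_eq_sub_of_hasDerivAt key hcont.intervalIntegrable
  rw [intervalIntegral.integral_const_mul] at this
  rw [this]
  simp
end

section
/- For all ζ ≥ 0 the solution satisfies θ'(ζ) + aζ/2 ≥ 0. -/
open MeasureTheory Filter Set

theorem stmt_5 (a ρ₀ : ℝ) (ha : 0 < a) (hρ₀ : 0 < ρ₀)
    (ρ ρ' ρ'' θ θ' θ'' : ℝ → ℝ)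
    (hdρ : ∀ ζ ≥ (0:ℝ), HasDerivAt ρ (ρ' ζ) ζ)
    (hdρ' : ∀ ζ ≥ (0:ℝ), HasDerivAt ρ' (ρ'' ζ) ζ)
    (hdθ : ∀ ζ ≥ (0:ℝ), HasDerivAt θ (θ' ζ) ζ)
    (hdθ' : ∀ ζ ≥ (0:ℝ), HasDerivAt θ' (θ'' ζ) ζ)
    (hcρ : ContinuousOn ρ'' (Set.Ici 0))
    (hcθ : ContinuousOn θ'' (Set.Ici 0))
    (hpos : ∀ ζ ≥ (0:ℝ), 0 < ρ ζ)
    (hode1 : ∀ ζ > (0:ℝ), ρ'' ζ + (2/ζ) * ρ' ζ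
        = ρ ζ * ((θ' ζ)^2 + a * ζ * θ' ζ + 1 - (ρ ζ)^2))
    (hode2 : ∀ ζ > (0:ℝ), θ'' ζ + (2/ζ) * θ' ζ + 2 * (ρ' ζ / ρ ζ) * θ' ζ
        = -a * (ρ ζ + ζ * ρ' ζ) / ρ ζ)
    (hinit0 : ρ 0 = ρ₀) (hinit1 : ρ' 0 = 0) (hinit2 : θ 0 = 0) (hinit3 : θ' 0 = 0)
    :
    ∀ ζ ≥ (0:ℝ), 0 ≤ θ' ζ + a * ζ / 2 := by
  intro z hz
  have hD : ∀ x ≥ (0:ℝ), HasDerivAt (fun x => x^2 * (ρ x)^2 * (θ' x + a * x / 2))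
      ((2 * x * (ρ x)^2 + x^2 * (2 * ρ x * ρ' x)) * (θ' x + a * x / 2)
        + x^2 * (ρ x)^2 * (θ'' x + a / 2)) x := by
    intro x hx
    have h1 : HasDerivAt (fun x : ℝ => x^2) (2 * x) x := by
      simpa using hasDerivAt_pow 2 x
    have h2 : HasDerivAt (fun x : ℝ => (ρ x)^2) (2 * ρ x * ρ' x) x := by
      have := (hdρ x hx).fun_pow 2
      simpa using this
    have h3 : HasDerivAt (fun x : ℝ => θ' x + a * x / 2) (θ'' x + a / 2) x := by
      have h4 : HasDerivAt (fun x : ℝ => a * x / 2) (a / 2) x := by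
        simpa using ((hasDerivAt_id x).const_mul a).div_const 2
      exact (hdθ' x hx).add h4
    exact (h1.mul h2).mul h3
  have hmono : MonotoneOn (fun x => x^2 * (ρ x)^2 * (θ' x + a * x / 2)) (Set.Ici 0) := by
    apply monotoneOn_of_deriv_nonneg (convex_Ici 0)
    · exact fun x hx => (hD x hx).continuousAt.continuousWithinAt
    · intro x hx
      rw [interior_Ici] at hx
      exact (hD x (le_of_lt hx)).differentiableAt.differentiableWithinAt
    · intro x hx
      rw [interior_Ici] at hx
      have hx0 : (0:ℝ) < x := hx
      rw [(hD x hx0.le).deriv]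
      have hr := hpos x hx0.le
      have e := hode2 x hx0
      have e2 : θ'' x = -a * (ρ x + x * ρ' x) / ρ x - (2/x) * θ' x
          - 2 * (ρ' x / ρ x) * θ' x := by linarith
      have : (2 * x * (ρ x)^2 + x^2 * (2 * ρ x * ρ' x)) * (θ' x + a * x / 2)
        + x^2 * (ρ x)^2 * (θ'' x + a / 2) = a / 2 * x^2 * (ρ x)^2 := by
        rw [e2]
        field_simp
        ring
      rw [this]
      positivity
  rcases eq_or_lt_of_le hz with h | h
  · rw [← h, hinit3]; simp
  · have := hmono (Set.mem_Ici.2 le_rfl) (Set.mem_Ici.2 hz) hz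
    have hr := hpos z hz
    have h5 : 0 ≤ z^2 * (ρ z)^2 * (θ' z + a * z / 2) := by simpa using this
    exact nonneg_of_mul_nonneg_right h5 (by positivity)
end

section
/- The integral ∫₀^ζ (tρ(t))² dt tends to infinity as ζ → ∞. -/
open MeasureTheory Filter Set

theorem stmt_7 (a ρ₀ : ℝ) (ha : 0 < a) (hρ₀ : 0 < ρ₀)
    (ρ ρ' ρ'' θ θ' θ'' : ℝ → ℝ)
    (hdρ : ∀ ζ ≥ (0:ℝ), HasDerivAt ρ (ρ' ζ) ζ)
    (hdρ' : ∀ ζ ≥ (0:ℝ), HasDerivAt ρ' (ρ'' ζ) ζ)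
    (hdθ : ∀ ζ ≥ (0:ℝ), HasDerivAt θ (θ' ζ) ζ)
    (hdθ' : ∀ ζ ≥ (0:ℝ), HasDerivAt θ' (θ'' ζ) ζ)
    (hcρ : ContinuousOn ρ'' (Set.Ici 0))
    (hcθ : ContinuousOn θ'' (Set.Ici 0))
    (hpos : ∀ ζ ≥ (0:ℝ), 0 < ρ ζ)
    (hode1 : ∀ ζ > (0:ℝ), ρ'' ζ + (2/ζ) * ρ' ζ
        = ρ ζ * ((θ' ζ)^2 + a * ζ * θ' ζ + 1 - (ρ ζ)^2))
    (hode2 : ∀ ζ > (0:ℝ), θ'' ζ + (2/ζ) * θ' ζ + 2 * (ρ' ζ / ρ ζ) * θ' ζ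
        = -a * (ρ ζ + ζ * ρ' ζ) / ρ ζ)
    (hinit0 : ρ 0 = ρ₀) (hinit1 : ρ' 0 = 0) (hinit2 : θ 0 = 0) (hinit3 : θ' 0 = 0)
    (hbound : ∃ M > 0, ∀ ζ ≥ (0:ℝ), ζ * ρ ζ ≤ M ∧ |ζ * ρ' ζ| ≤ M ∧ ζ * ρ ζ * |θ' ζ| ≤ M)
    :
    Tendsto (fun ζ => ∫ t in (0:ℝ)..ζ, (t * ρ t)^2) atTop atTop := by
  obtain ⟨M, hM, hb⟩ := hbound
  set H : ℝ → ℝ := fun t => t * (t * ρ t)^2 + (2/a) * ((t * ρ t)^2 * θ' t) with hH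
  have hHd : ∀ t ≥ (0:ℝ), HasDerivAt H ((t * ρ t)^2) t := by
    intro t ht
    have hf : HasDerivAt (fun t => t * ρ t) (1 * ρ t + t * ρ' t) t :=
      (hasDerivAt_id t).mul (hdρ t ht)
    have hf2 := hf.pow 2
    have h1 := ((hasDerivAt_id t).mul hf2).add ((hf2.mul (hdθ' t ht)).const_mul (2/a))
    refine h1.congr_deriv ?_
    rcases eq_or_lt_of_le ht with h0 | h0
    · simp [← h0]
    · have hp := hpos t ht
      have h2 : θ'' t = -a * (ρ t + t * ρ' t) / ρ t - (2/t) * θ' t - 2 * (ρ' t / ρ t) * θ' t := by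
        linarith [hode2 t h0]
      rw [h2]
      simp
      field_simp
      ring
  have hcont : ContinuousOn H (Ici 0) := fun t ht => (hHd t ht).continuousAt.continuousWithinAt
  have hmono : StrictMonoOn H (Ici 0) := by
    apply strictMonoOn_of_deriv_pos (convex_Ici 0) hcont
    intro t ht
    rw [interior_Ici] at ht
    have ht' : 0 < t := ht
    rw [(hHd t ht'.le).deriv]
    have := hpos t ht'.le
    positivity
  have hH0 : H 0 = 0 := by simp [hH]
  have hc : 0 < H 1 := by
    rw [← hH0]; exact hmono (by simp) (by simp) one_pos
  have hint : ∀ ζ ≥ (0:ℝ), ∫ t in (0:ℝ)..ζ, (t * ρ t)^2 = H ζ := by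
    intro ζ hζ
    rw [intervalIntegral.integral_eq_sub_of_hasDerivAt (f := H), hH0, sub_zero]
    · intro t ht
      rw [uIcc_of_le hζ] at ht
      exact hHd t ht.1
    · apply ContinuousOn.intervalIntegrable
      intro t ht
      rw [uIcc_of_le hζ] at ht
      exact ((continuousAt_id.mul (hdρ t ht.1).continuousAt).pow 2).continuousWithinAt
  obtain ⟨c, hcdef⟩ : ∃ c, c = H 1 := ⟨_, rfl⟩
  rw [← hcdef] at hc
  obtain ⟨C, hCdef⟩ : ∃ C, C = 2 / a * M := ⟨_, rfl⟩
  have hC : 0 < C := by rw [hCdef]; positivity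
  obtain ⟨k, hkdef⟩ : ∃ k, k = min (c/2) ((c/(2*C))^2) := ⟨_, rfl⟩
  have hk : 0 < k := by rw [hkdef]; positivity
  have hlow : ∀ t ≥ (1:ℝ), k / t ≤ (t * ρ t)^2 := by
    intro t ht
    have ht0 : 0 < t := by linarith
    have hf : 0 < t * ρ t := mul_pos ht0 (hpos t ht0.le)
    have h1 : c ≤ H t := by
      rw [hcdef]; exact hmono.monotoneOn (by simp) ht0.le ht
    have h2 : H t ≤ t * (t * ρ t)^2 + C * (t * ρ t) := by
      have h3 := (hb t ht0.le).2.2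
      have h4 : (t * ρ t)^2 * θ' t ≤ (t * ρ t) * M := by
        calc (t * ρ t)^2 * θ' t ≤ (t * ρ t)^2 * |θ' t| := by gcongr; exact le_abs_self _
          _ = (t * ρ t) * (t * ρ t * |θ' t|) := by ring
          _ ≤ _ := by gcongr
      have h5 : (2/a) * ((t * ρ t)^2 * θ' t) ≤ (2/a) * ((t * ρ t) * M) := by gcongr
      simp only [hH]
      rw [hCdef]
      linarith
    rw [div_le_iff₀ ht0]
    by_cases h : c / 2 ≤ C * (t * ρ t)
    · have h6 : c / (2 * C) ≤ t * ρ t := by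
        rw [div_le_iff₀ (by positivity)]; linarith
      calc k ≤ (c/(2*C))^2 := by rw [hkdef]; exact min_le_right _ _
        _ ≤ (t * ρ t)^2 := by gcongr
        _ ≤ (t * ρ t)^2 * t := le_mul_of_one_le_right (by positivity) ht
    · have : k ≤ c/2 := by rw [hkdef]; exact min_le_left _ _
      linarith
  have hDd : ∀ t ≥ (1:ℝ), HasDerivAt (fun t => H t - k * Real.log t) ((t * ρ t)^2 - k * t⁻¹) t := by
    intro t ht
    exact (hHd t (by linarith)).sub ((Real.hasDerivAt_log (by linarith)).const_mul k)
  have hmono2 : MonotoneOn (fun t => H t - k * Real.log t) (Ici 1) := by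
    apply monotoneOn_of_deriv_nonneg (convex_Ici 1)
    · exact fun t ht => (hDd t ht).continuousAt.continuousWithinAt
    · intro t ht
      rw [interior_Ici] at ht
      exact (hDd t (le_of_lt ht)).differentiableAt.differentiableWithinAt
    · intro t ht
      rw [interior_Ici] at ht
      rw [(hDd t (le_of_lt ht)).deriv]
      have := hlow t (le_of_lt ht)
      rw [div_eq_mul_inv] at this
      linarith
  refine tendsto_atTop_mono' atTop ?_ (Real.tendsto_log_atTop.const_mul_atTop hk)
  filter_upwards [eventually_ge_atTop (1:ℝ)] with t ht
  rw [hint t (by linarith)]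
  have h7 := hmono2 (by simp) ht ht
  simp only [Real.log_one] at h7
  linarith
end

section
/- The quantity ζ(ζρ(ζ))² tends to infinity as ζ → ∞. -/
open MeasureTheory Filter Set

theorem stmt_8 (a ρ₀ : ℝ) (ha : 0 < a) (hρ₀ : 0 < ρ₀)
    (ρ ρ' ρ'' θ θ' θ'' : ℝ → ℝ)
    (hdρ : ∀ ζ ≥ (0:ℝ), HasDerivAt ρ (ρ' ζ) ζ)
    (hdρ' : ∀ ζ ≥ (0:ℝ), HasDerivAt ρ' (ρ'' ζ) ζ)
    (hdθ : ∀ ζ ≥ (0:ℝ), HasDerivAt θ (θ' ζ) ζ)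
    (hdθ' : ∀ ζ ≥ (0:ℝ), HasDerivAt θ' (θ'' ζ) ζ)
    (hcρ : ContinuousOn ρ'' (Set.Ici 0))
    (hcθ : ContinuousOn θ'' (Set.Ici 0))
    (hpos : ∀ ζ ≥ (0:ℝ), 0 < ρ ζ)
    (hode1 : ∀ ζ > (0:ℝ), ρ'' ζ + (2/ζ) * ρ' ζ
        = ρ ζ * ((θ' ζ)^2 + a * ζ * θ' ζ + 1 - (ρ ζ)^2))
    (hode2 : ∀ ζ > (0:ℝ), θ'' ζ + (2/ζ) * θ' ζ + 2 * (ρ' ζ / ρ ζ) * θ' ζ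
        = -a * (ρ ζ + ζ * ρ' ζ) / ρ ζ)
    (hinit0 : ρ 0 = ρ₀) (hinit1 : ρ' 0 = 0) (hinit2 : θ 0 = 0) (hinit3 : θ' 0 = 0)
    (hbound : ∃ M > 0, ∀ ζ ≥ (0:ℝ), ζ * ρ ζ ≤ M ∧ |ζ * ρ' ζ| ≤ M ∧ ζ * ρ ζ * |θ' ζ| ≤ M)
    :
    Tendsto (fun ζ => ζ * (ζ * ρ ζ)^2) atTop atTop := by
  obtain ⟨M, hM, hb⟩ := hbound
  set J : ℝ → ℝ := fun ζ => ζ * (ζ * ρ ζ)^2 + (2/a) * ((ζ * ρ ζ)^2 * θ' ζ) with hJ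
  have hd0 : ∀ ζ ≥ (0:ℝ), HasDerivAt J ((1 * (ζ * ρ ζ)^2 + ζ * (2 * (ζ * ρ ζ) * (1 * ρ ζ + ζ * ρ' ζ)))
      + (2/a) * ((2 * (ζ * ρ ζ) * (1 * ρ ζ + ζ * ρ' ζ)) * θ' ζ + (ζ * ρ ζ)^2 * θ'' ζ)) ζ := by
    intro ζ hζ
    have h1 : HasDerivAt (fun x => x * ρ x) (1 * ρ ζ + ζ * ρ' ζ) ζ := (hasDerivAt_id ζ).mul (hdρ ζ hζ)
    have h2 : HasDerivAt (fun x => (x * ρ x)^2) (2 * (ζ * ρ ζ) * (1 * ρ ζ + ζ * ρ' ζ)) ζ := by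
      have h : HasDerivAt (fun x => (x * ρ x) * (x * ρ x)) ((1 * ρ ζ + ζ * ρ' ζ) * (ζ * ρ ζ)
          + ζ * ρ ζ * (1 * ρ ζ + ζ * ρ' ζ)) ζ := h1.mul h1
      have e1 : (fun x => (x * ρ x)^2) = (fun x => (x * ρ x) * (x * ρ x)) := by
        funext x
        ring
      have e2 : 2 * (ζ * ρ ζ) * (1 * ρ ζ + ζ * ρ' ζ) = (1 * ρ ζ + ζ * ρ' ζ) * (ζ * ρ ζ)
          + ζ * ρ ζ * (1 * ρ ζ + ζ * ρ' ζ) := by ring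
      rw [e1, e2]
      exact h
    have h3 := (hasDerivAt_id ζ).mul h2
    have h4 := (h2.mul (hdθ' ζ hζ)).const_mul (2/a)
    exact h3.add h4
  have hd : ∀ ζ > (0:ℝ), HasDerivAt J ((ζ * ρ ζ)^2) ζ := by
    intro ζ hζ
    have hp := hpos ζ hζ.le
    have h := hode2 ζ hζ
    convert hd0 ζ hζ.le using 1
    have e : θ'' ζ = -a * (ρ ζ + ζ * ρ' ζ) / ρ ζ - (2/ζ) * θ' ζ - 2 * (ρ' ζ / ρ ζ) * θ' ζ := by linarith
    rw [e]
    field_simp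
    ring
  have hcont : ContinuousOn J (Ici 0) := fun x hx => (hd0 x hx).continuousAt.continuousWithinAt
  have hmono : StrictMonoOn J (Ici 0) := by
    apply strictMonoOn_of_deriv_pos (convex_Ici 0) hcont
    intro x hx
    rw [interior_Ici] at hx
    have hx' : (0:ℝ) < x := hx
    rw [(hd x hx').deriv]
    have := hpos x hx'.le
    positivity
  have hJ0 : J 0 = 0 := by simp [hJ]
  have hc : 0 < J 1 := by
    rw [← hJ0]; exact hmono (by simp) (by simp) one_pos
  -- comparison
  have hcmp : ∀ ζ ≥ (0:ℝ), |J ζ - ζ * (ζ * ρ ζ)^2| ≤ (2 * M / a) * (ζ * ρ ζ) := by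
    intro ζ hζ
    obtain ⟨_, _, h3⟩ := hb ζ hζ
    have hR : 0 ≤ ζ * ρ ζ := mul_nonneg hζ (hpos ζ hζ).le
    have e : J ζ - ζ * (ζ * ρ ζ)^2 = (2/a) * ((ζ * ρ ζ) * ((ζ * ρ ζ) * θ' ζ)) := by
      simp only [hJ]; ring
    rw [e, abs_mul (2/a), abs_mul (ζ * ρ ζ) (ζ * ρ ζ * θ' ζ), abs_mul (ζ * ρ ζ) (θ' ζ), abs_of_nonneg hR,
      abs_of_pos (by positivity : 0 < 2/a)]
    calc 2 / a * (ζ * ρ ζ * (ζ * ρ ζ * |θ' ζ|)) ≤ 2 / a * (ζ * ρ ζ * M) := by gcongr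
      _ = _ := by ring
  have hcmp2 : ∀ ζ ≥ (0:ℝ), |J ζ - ζ * (ζ * ρ ζ)^2| ≤ (2 * M / a) * M := by
    intro ζ hζ
    refine (hcmp ζ hζ).trans ?_
    have := (hb ζ hζ).1
    gcongr
  -- J is unbounded
  have hunb : ∀ B : ℝ, ∃ ζ ≥ (0:ℝ), B < J ζ := by
    by_contra! hcon
    obtain ⟨B, hB⟩ := hcon
    set c := J 1 with hcdef
    set B' := B + 2 * M / a * M with hB'
    have hR : Tendsto (fun ζ : ℝ => (2 * M / a)^2 * B' / ζ) atTop (nhds 0) :=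
      tendsto_const_nhds.div_atTop tendsto_id
    have hev : ∀ᶠ ζ : ℝ in atTop, (2 * M / a)^2 * B' / ζ < (c/2)^2 :=
      hR.eventually (gt_mem_nhds (by positivity))
    obtain ⟨z, hz⟩ := eventually_atTop.1 (hev.and (eventually_ge_atTop 1))
    have hz1 : 1 ≤ z := (hz z le_rfl).2
    have hlow : ∀ ζ ≥ z, c / 2 * ζ⁻¹ ≤ (ζ * ρ ζ)^2 := by
      intro ζ hζ
      obtain ⟨h1, h2⟩ := hz ζ hζ
      have hζ0 : 0 < ζ := by linarith
      have hRp : 0 ≤ ζ * ρ ζ := mul_nonneg hζ0.le (hpos ζ hζ0.le).le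
      have hJc : c ≤ J ζ := hmono.monotoneOn (by simp) hζ0.le h2
      have hup : ζ * (ζ * ρ ζ)^2 ≤ B' := by
        have := (abs_le.1 (hcmp2 ζ hζ0.le)).1
        have := hB ζ hζ0.le
        linarith
      have hR2 : (ζ * ρ ζ)^2 ≤ B' / ζ := by
        rw [le_div_iff₀ hζ0]; linarith
      have hsm : (2 * M / a) * (ζ * ρ ζ) ≤ c / 2 := by
        apply le_of_sq_le_sq _ (by positivity)
        calc (2 * M / a * (ζ * ρ ζ))^2 = (2 * M / a)^2 * (ζ * ρ ζ)^2 := by ring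
          _ ≤ (2 * M / a)^2 * (B' / ζ) := by gcongr
          _ = (2 * M / a)^2 * B' / ζ := by ring
          _ ≤ _ := h1.le
      have := (abs_le.1 (hcmp ζ hζ0.le)).2
      rw [← div_eq_mul_inv, div_le_iff₀ hζ0]
      linarith
    have hK : MonotoneOn (fun ζ => J ζ - c / 2 * Real.log ζ) (Ici z) := by
      have hdK : ∀ ζ ≥ z, HasDerivAt (fun ζ => J ζ - c / 2 * Real.log ζ) ((ζ * ρ ζ)^2 - c / 2 * ζ⁻¹) ζ := by
        intro ζ hζ
        have hζ0 : 0 < ζ := by linarith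
        exact (hd ζ hζ0).sub ((Real.hasDerivAt_log hζ0.ne').const_mul _)
      apply monotoneOn_of_deriv_nonneg (convex_Ici z)
      · exact fun x hx => (hdK x hx).continuousAt.continuousWithinAt
      · intro x hx
        exact (hdK x (interior_subset hx)).differentiableAt.differentiableWithinAt
      · intro x hx
        rw [(hdK x (interior_subset hx)).deriv]
        linarith [hlow x (interior_subset hx)]
    have hlog : Tendsto (fun ζ => c / 2 * Real.log ζ) atTop atTop :=
      Real.tendsto_log_atTop.const_mul_atTop (by positivity)
    obtain ⟨y, hy1, hy2⟩ := ((hlog.eventually_gt_atTop (B - (J z - c / 2 * Real.log z))).and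
      (eventually_ge_atTop z)).exists
    have h1 := hK (le_refl z : z ∈ Ici z) hy2 hy2
    have h2 := hB y (by linarith)
    simp only at h1
    linarith
  rw [tendsto_atTop]
  intro b
  obtain ⟨z, hz0, hz⟩ := hunb (b + 2 * M / a * M)
  filter_upwards [eventually_ge_atTop z] with ζ hζ
  have hζ0 : 0 ≤ ζ := hz0.trans hζ
  have h1 := hmono.monotoneOn hz0 hζ0 hζ
  have h2 := (abs_le.1 (hcmp2 ζ hζ0)).2
  linarith
end

section
/- The ratio (∫₀^ζ (tρ(t))² dt) / (ζ(ζρ(ζ))²) tends to 1 as ζ → ∞. -/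
open MeasureTheory Filter Set

theorem stmt_10 (a ρ₀ : ℝ) (ha : 0 < a) (hρ₀ : 0 < ρ₀)
    (ρ ρ' ρ'' θ θ' θ'' : ℝ → ℝ)
    (hdρ : ∀ ζ ≥ (0:ℝ), HasDerivAt ρ (ρ' ζ) ζ)
    (hdρ' : ∀ ζ ≥ (0:ℝ), HasDerivAt ρ' (ρ'' ζ) ζ)
    (hdθ : ∀ ζ ≥ (0:ℝ), HasDerivAt θ (θ' ζ) ζ)
    (hdθ' : ∀ ζ ≥ (0:ℝ), HasDerivAt θ' (θ'' ζ) ζ)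
    (hcρ : ContinuousOn ρ'' (Set.Ici 0))
    (hcθ : ContinuousOn θ'' (Set.Ici 0))
    (hpos : ∀ ζ ≥ (0:ℝ), 0 < ρ ζ)
    (hode1 : ∀ ζ > (0:ℝ), ρ'' ζ + (2/ζ) * ρ' ζ
        = ρ ζ * ((θ' ζ)^2 + a * ζ * θ' ζ + 1 - (ρ ζ)^2))
    (hode2 : ∀ ζ > (0:ℝ), θ'' ζ + (2/ζ) * θ' ζ + 2 * (ρ' ζ / ρ ζ) * θ' ζ
        = -a * (ρ ζ + ζ * ρ' ζ) / ρ ζ)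
    (hinit0 : ρ 0 = ρ₀) (hinit1 : ρ' 0 = 0) (hinit2 : θ 0 = 0) (hinit3 : θ' 0 = 0)
    (hbound : ∃ M > 0, ∀ ζ ≥ (0:ℝ), ζ * ρ ζ ≤ M ∧ |ζ * ρ' ζ| ≤ M ∧ ζ * ρ ζ * |θ' ζ| ≤ M)
    :
    Tendsto (fun ζ => (∫ t in (0:ℝ)..ζ, (t * ρ t)^2) / (ζ * (ζ * ρ ζ)^2))
      atTop (nhds 1) := by
  obtain ⟨M, hM, hb⟩ := hbound
  have hcont : ContinuousOn (fun t => (t * ρ t)^2) (Set.Ici 0) := by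
    intro t ht
    exact ((continuousAt_id.mul (hdρ t ht).continuousAt).pow 2).continuousWithinAt
  have hint : ∀ x y : ℝ, 0 ≤ x → 0 ≤ y → IntervalIntegrable (fun t => (t * ρ t)^2) volume x y := by
    intro x y hx hy
    apply ContinuousOn.intervalIntegrable
    apply hcont.mono
    intro t ht
    exact le_trans (le_min hx hy) ht.1
  have hI : ∀ ζ ≥ (0:ℝ), (∫ t in (0:ℝ)..ζ, (t * ρ t)^2)
      = (2/a) * ((ζ * ρ ζ)^2 * θ' ζ) + ζ * (ζ * ρ ζ)^2 := by
    intro ζ hζ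
    rw [intervalIntegral.integral_eq_sub_of_hasDerivAt
      (f := fun ζ => (2/a) * ((ζ * ρ ζ)^2 * θ' ζ) + ζ * (ζ * ρ ζ)^2) _ (hint 0 ζ le_rfl hζ)]
    · simp
    · intro t ht
      rw [uIcc_of_le hζ] at ht
      have ht0 : 0 ≤ t := ht.1
      have h1 := ((hasDerivAt_id t).mul (hdρ t ht0)).pow 2
      have h2 := ((h1.mul (hdθ' t ht0)).const_mul (2/a)).add ((hasDerivAt_id t).mul h1)
      refine HasDerivAt.congr_deriv (f := fun ζ => (2/a) * ((ζ * ρ ζ)^2 * θ' ζ) + ζ * (ζ * ρ ζ)^2) h2 ?_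
      rcases ht0.eq_or_lt with h0 | h0
      · subst h0; simp
      · have hp := hpos t ht0
        have e : θ'' t = -a * (ρ t + t * ρ' t) / ρ t - (2/t) * θ' t - 2 * (ρ' t / ρ t) * θ' t := by
          linarith [hode2 t h0]
        simp only [Pi.mul_apply, Pi.pow_apply, id]
        rw [e]
        field_simp
        push_cast
        ring
  set c := ∫ t in (0:ℝ)..1, (t * ρ t)^2 with hc
  have hcpos : 0 < c := by
    apply intervalIntegral.intervalIntegral_pos_of_pos_on (hint 0 1 le_rfl zero_le_one) _ zero_lt_one
    intro t ht
    have := hpos t ht.1.le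
    have := ht.1
    positivity
  have hIc : ∀ ζ ≥ (1:ℝ), c ≤ ∫ t in (0:ℝ)..ζ, (t * ρ t)^2 := by
    intro ζ hζ
    rw [← intervalIntegral.integral_add_adjacent_intervals (hint 0 1 le_rfl zero_le_one)
      (hint 1 ζ zero_le_one (by linarith))]
    have : 0 ≤ ∫ t in (1:ℝ)..ζ, (t * ρ t)^2 :=
      intervalIntegral.integral_nonneg hζ (fun t _ => sq_nonneg _)
    linarith
  set B := 2 * M / a with hB
  have hBpos : 0 < B := by positivity
  set δ := c / (1 + B + c) with hδ
  have hδpos : 0 < δ := by positivity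
  have hδ1 : δ < 1 := by rw [hδ, div_lt_one (by positivity)]; linarith
  have hδc : δ * (1 + B) < c := by
    have : δ * (1 + B + c) = c := by rw [hδ]; field_simp
    nlinarith [mul_pos hδpos hcpos]
  have key : ∀ ζ ≥ (1:ℝ), |θ' ζ| / ζ ≤ M / δ * (√ζ)⁻¹ := by
    intro ζ hζ
    have hζ0 : 0 < ζ := by linarith
    have hp := hpos ζ hζ0.le
    obtain ⟨-, -, h3⟩ := hb ζ hζ0.le
    have h4 := hIc ζ hζ
    rw [hI ζ hζ0.le] at h4
    set r := ζ * ρ ζ with hr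
    have hrpos : 0 < r := by positivity
    have hs1 : 1 ≤ √ζ := by rw [Real.one_le_sqrt]; exact hζ
    have hss : √ζ * √ζ = ζ := Real.mul_self_sqrt hζ0.le
    set s := √ζ with hs
    have h5 : (2/a) * (r^2 * θ' ζ) ≤ B * r := by
      have : r^2 * θ' ζ ≤ M * r := by
        have := le_abs_self (θ' ζ)
        have h6 : r * θ' ζ ≤ M := le_trans (mul_le_mul_of_nonneg_left this hrpos.le) h3
        nlinarith
      calc (2/a) * (r^2 * θ' ζ) ≤ (2/a) * (M * r) := mul_le_mul_of_nonneg_left this (by positivity)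
        _ = B * r := by rw [hB]; ring
    have h7 : δ ≤ r * s := by
      by_contra hlt
      push Not at hlt
      have h8 : r ≤ r * s := by nlinarith
      have h9 : c ≤ B * (r * s) + (r * s)^2 := by
        have : ζ * r^2 = (r*s)^2 := by rw [← hss]; ring
        have := mul_le_mul_of_nonneg_left h8 hBpos.le
        linarith
      have h10 : 0 < r * s := by positivity
      nlinarith
    have hspos : 0 < s := by linarith
    rw [← div_eq_mul_inv, div_div, div_le_div_iff₀ hζ0 (by positivity)]
    have h11 : |θ' ζ| * δ ≤ M * s := by
      calc |θ' ζ| * δ ≤ |θ' ζ| * (r * s) := mul_le_mul_of_nonneg_left h7 (abs_nonneg _)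
        _ = (r * |θ' ζ|) * s := by ring
        _ ≤ M * s := mul_le_mul_of_nonneg_right h3 hspos.le
    have h12 : M * ζ = M * (s * s) := by rw [hss]
    rw [h12]
    nlinarith
  have hlim : Tendsto (fun ζ => θ' ζ / ζ) atTop (nhds 0) := by
    have h0 : Tendsto (fun ζ : ℝ => M / δ * (√ζ)⁻¹) atTop (nhds 0) := by
      simpa using (tendsto_inv_atTop_zero.comp Real.tendsto_sqrt_atTop).const_mul (M / δ)
    apply squeeze_zero_norm' _ h0
    filter_upwards [eventually_ge_atTop (1:ℝ)] with ζ hζ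
    rw [Real.norm_eq_abs, abs_div, abs_of_pos (show 0 < ζ by linarith)]
    exact key ζ hζ
  have hlim2 : Tendsto (fun ζ => 1 + (2/a) * (θ' ζ / ζ)) atTop (nhds 1) := by
    simpa using (hlim.const_mul (2/a)).const_add 1
  refine hlim2.congr' ?_
  filter_upwards [eventually_ge_atTop (1:ℝ)] with ζ hζ
  have hζ0 : 0 < ζ := by linarith
  have hp := hpos ζ hζ0.le
  rw [hI ζ hζ0.le]
  field_simp
  ring
end

section
/- The energy E satisfies E(0) = ρ₀² and is differentiable on (0,∞) with E'(ζ) = −ζρ(ζ)⁴ < 0 for all ζ > 0; in particular E is strictly decreasing on [0,∞). -/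
open MeasureTheory Filter Set

theorem stmt_11 (a ρ₀ : ℝ) (ha : 0 < a) (hρ₀ : 0 < ρ₀)
    (ρ ρ' ρ'' θ θ' θ'' : ℝ → ℝ)
    (hdρ : ∀ ζ ≥ (0:ℝ), HasDerivAt ρ (ρ' ζ) ζ)
    (hdρ' : ∀ ζ ≥ (0:ℝ), HasDerivAt ρ' (ρ'' ζ) ζ)
    (hdθ : ∀ ζ ≥ (0:ℝ), HasDerivAt θ (θ' ζ) ζ)
    (hdθ' : ∀ ζ ≥ (0:ℝ), HasDerivAt θ' (θ'' ζ) ζ)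
    (hcρ : ContinuousOn ρ'' (Set.Ici 0))
    (hcθ : ContinuousOn θ'' (Set.Ici 0))
    (hpos : ∀ ζ ≥ (0:ℝ), 0 < ρ ζ)
    (hode1 : ∀ ζ > (0:ℝ), ρ'' ζ + (2/ζ) * ρ' ζ
        = ρ ζ * ((θ' ζ)^2 + a * ζ * θ' ζ + 1 - (ρ ζ)^2))
    (hode2 : ∀ ζ > (0:ℝ), θ'' ζ + (2/ζ) * θ' ζ + 2 * (ρ' ζ / ρ ζ) * θ' ζ
        = -a * (ρ ζ + ζ * ρ' ζ) / ρ ζ)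
    (hinit0 : ρ 0 = ρ₀) (hinit1 : ρ' 0 = 0) (hinit2 : θ 0 = 0) (hinit3 : θ' 0 = 0)
    (E : ℝ → ℝ)
    (hE : ∀ ζ, E ζ = (ρ ζ + ζ * ρ' ζ)^2 + ζ^2 * (ρ ζ)^2 * ((θ' ζ)^2 - 1)
        + (1/2) * ζ^2 * (ρ ζ)^4)
    :
    E 0 = ρ₀^2 ∧
    (∀ ζ > (0:ℝ), HasDerivAt E (-ζ * (ρ ζ)^4) ζ ∧ -ζ * (ρ ζ)^4 < 0) ∧
    StrictAntiOn E (Set.Ici 0) := by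
  have hEf : E = fun ζ => (ρ ζ + ζ * ρ' ζ)^2 + ζ^2 * (ρ ζ)^2 * ((θ' ζ)^2 - 1)
        + (1/2) * ζ^2 * (ρ ζ)^4 := funext hE
  have key : ∀ ζ ≥ (0:ℝ), HasDerivAt E
      (2 * (ρ ζ + ζ * ρ' ζ) * (2 * ρ' ζ + ζ * ρ'' ζ)
        + (2 * ζ * (ρ ζ)^2 + ζ^2 * (2 * ρ ζ * ρ' ζ)) * ((θ' ζ)^2 - 1)
        + ζ^2 * (ρ ζ)^2 * (2 * θ' ζ * θ'' ζ)
        + (ζ * (ρ ζ)^4 + (1/2) * ζ^2 * (4 * (ρ ζ)^3 * ρ' ζ))) ζ := by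
    intro ζ hζ
    have h1 := hdρ ζ hζ
    have h2 := hdρ' ζ hζ
    have h3 := hdθ' ζ hζ
    have hi := hasDerivAt_id' ζ
    rw [hEf]
    have A := (h1.fun_add (hi.fun_mul h2)).fun_pow 2
    have B := ((hi.fun_pow 2).fun_mul (h1.fun_pow 2)).fun_mul ((h3.fun_pow 2).sub_const 1)
    have C := ((hi.fun_pow 2).const_mul (1/2 : ℝ)).fun_mul (h1.fun_pow 4)
    refine ((A.fun_add B).fun_add C).congr_deriv ?_
    norm_num
    ring
  have key2 : ∀ ζ > (0:ℝ), HasDerivAt E (-ζ * (ρ ζ)^4) ζ ∧ -ζ * (ρ ζ)^4 < 0 := by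
    intro ζ hζ
    have hp := hpos ζ hζ.le
    constructor
    · refine (key ζ hζ.le).congr_deriv ?_
      have e1 : 2 * ρ' ζ + ζ * ρ'' ζ
          = ζ * (ρ ζ * ((θ' ζ)^2 + a * ζ * θ' ζ + 1 - (ρ ζ)^2)) := by
        rw [← hode1 ζ hζ]
        field_simp
        ring
      have e2 : ζ * ρ ζ * θ'' ζ
          = -a * ζ * (ρ ζ + ζ * ρ' ζ) - 2 * θ' ζ * (ρ ζ + ζ * ρ' ζ) := by
        have h := hode2 ζ hζ
        field_simp at h
        linear_combination h
      rw [e1]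
      linear_combination (2 * ζ * ρ ζ * θ' ζ) * e2
    · have : 0 < ζ * (ρ ζ)^4 := by positivity
      linarith
  refine ⟨by rw [hE, hinit0]; ring, key2, ?_⟩
  refine strictAntiOn_of_deriv_neg (convex_Ici 0)
    (fun x hx => (key x hx).continuousAt.continuousWithinAt) ?_
  intro x hx
  rw [interior_Ici] at hx
  rw [(key2 x hx).1.deriv]
  exact (key2 x hx).2
end

section
/- For all ζ ≥ 0, the integrated energy identity (ρ(ζ) + ζρ'(ζ))² + ζ²ρ(ζ)²(θ'(ζ)² − 1) + (1/2)ζ²ρ(ζ)⁴ = ρ₀² − ∫₀^ζ tρ(t)⁴ dt holds. -/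
open MeasureTheory Filter Set

theorem stmt_12 (a ρ₀ : ℝ) (ha : 0 < a) (hρ₀ : 0 < ρ₀)
    (ρ ρ' ρ'' θ θ' θ'' : ℝ → ℝ)
    (hdρ : ∀ ζ ≥ (0:ℝ), HasDerivAt ρ (ρ' ζ) ζ)
    (hdρ' : ∀ ζ ≥ (0:ℝ), HasDerivAt ρ' (ρ'' ζ) ζ)
    (hdθ : ∀ ζ ≥ (0:ℝ), HasDerivAt θ (θ' ζ) ζ)
    (hdθ' : ∀ ζ ≥ (0:ℝ), HasDerivAt θ' (θ'' ζ) ζ)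
    (hcρ : ContinuousOn ρ'' (Set.Ici 0))
    (hcθ : ContinuousOn θ'' (Set.Ici 0))
    (hpos : ∀ ζ ≥ (0:ℝ), 0 < ρ ζ)
    (hode1 : ∀ ζ > (0:ℝ), ρ'' ζ + (2/ζ) * ρ' ζ
        = ρ ζ * ((θ' ζ)^2 + a * ζ * θ' ζ + 1 - (ρ ζ)^2))
    (hode2 : ∀ ζ > (0:ℝ), θ'' ζ + (2/ζ) * θ' ζ + 2 * (ρ' ζ / ρ ζ) * θ' ζ
        = -a * (ρ ζ + ζ * ρ' ζ) / ρ ζ)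
    (hinit0 : ρ 0 = ρ₀) (hinit1 : ρ' 0 = 0) (hinit2 : θ 0 = 0) (hinit3 : θ' 0 = 0)
    :
    ∀ ζ ≥ (0:ℝ), (ρ ζ + ζ * ρ' ζ)^2 + ζ^2 * (ρ ζ)^2 * ((θ' ζ)^2 - 1)
        + (1/2) * ζ^2 * (ρ ζ)^4
      = ρ₀^2 - ∫ t in (0:ℝ)..ζ, t * (ρ t)^4 := by
  intro ζ hζ
  have key : ∀ t ≥ (0:ℝ), HasDerivAt (fun ζ => (ρ ζ + ζ * ρ' ζ)^2
      + ζ^2 * (ρ ζ)^2 * ((θ' ζ)^2 - 1) + (1/2) * ζ^2 * (ρ ζ)^4) (-(t * (ρ t)^4)) t := by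
    intro t ht
    have h1 := hdρ t ht
    have h2 := hdρ' t ht
    have h3 := hdθ' t ht
    have hid := hasDerivAt_id' t
    have hA := (h1.fun_add (hid.fun_mul h2)).fun_pow 2
    have hB := ((hid.fun_pow 2).fun_mul (h1.fun_pow 2)).fun_mul ((h3.fun_pow 2).sub_const 1)
    have hC := ((hid.fun_pow 2).const_mul (1/2 : ℝ)).fun_mul (h1.fun_pow 4)
    refine ((hA.fun_add hB).fun_add hC).congr_deriv ?_
    rcases eq_or_lt_of_le ht with h0 | h0
    · rw [← h0]
      simp [hinit1]
    · have e1 := hode1 t h0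
      have e2 := hode2 t h0
      have hp := hpos t ht
      have f1 : t * ρ'' t = t * (ρ t * ((θ' t)^2 + a * t * θ' t + 1 - (ρ t)^2)) - 2 * ρ' t := by
        rw [← e1]
        field_simp
        ring
      have f2 : t * ρ t * θ'' t
          = - a * t * (ρ t + t * ρ' t) - 2 * (ρ t + t * ρ' t) * θ' t := by
        field_simp at e2
        linear_combination e2
      push_cast
      norm_num
      linear_combination (2 * (ρ t + t * ρ' t)) * f1 + (2 * t * ρ t * θ' t) * f2
  have hc : ContinuousOn (fun t => -(t * (ρ t)^4)) (Set.uIcc 0 ζ) := by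
    rw [Set.uIcc_of_le hζ]
    have hρc : ContinuousOn ρ (Set.Icc 0 ζ) := fun x hx =>
      (hdρ x hx.1).continuousAt.continuousWithinAt
    fun_prop
  have hint := intervalIntegral.integral_eq_sub_of_hasDerivAt (a := 0) (b := ζ)
    (fun x hx => key x (by rw [Set.uIcc_of_le hζ] at hx; exact hx.1)) hc.intervalIntegrable
  rw [intervalIntegral.integral_neg] at hint
  simp only [hinit0, hinit1] at hint
  linear_combination -hint
end

section
/- There exists a constant c > 0 such that ζ|Q(ζ)| → c as ζ → ∞; in particular |Q(ζ)| decays exactly like c/ζ at infinity. -/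
open MeasureTheory Filter Set

lemma aux_mono (k : ℝ) (F g w : ℝ → ℝ)
    (hF : ∀ z > (0:ℝ), HasDerivAt F ((g z)^2) z)
    (hFe : ∀ z > (0:ℝ), F z = z * (g z)^2 + k * w z)
    (e z0 : ℝ) (hz0 : 0 < z0) (hw : ∀ z ≥ z0, |k * w z| ≤ e) :
    MonotoneOn (fun z => F z / z - e / z) (Ici z0) := by
  have hder : ∀ z ≥ z0, HasDerivAt (fun z => F z / z - e / z)
      (((g z)^2 * z - F z * 1) / z^2 - (0 * z - e * 1) / z^2) z := by
    intro z hz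
    have hz' : 0 < z := lt_of_lt_of_le hz0 hz
    exact ((hF z hz').div (hasDerivAt_id z) hz'.ne').sub
      ((hasDerivAt_const z e).div (hasDerivAt_id z) hz'.ne')
  apply monotoneOn_of_deriv_nonneg (convex_Ici z0)
  · exact fun z hz => (hder z hz).continuousAt.continuousWithinAt
  · intro z hz
    rw [interior_Ici] at hz
    exact (hder z (le_of_lt hz)).differentiableAt.differentiableWithinAt
  · intro z hz
    rw [interior_Ici] at hz
    have hz1 : z0 ≤ z := le_of_lt hz
    have hz' : 0 < z := lt_of_lt_of_le hz0 hz1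
    rw [(hder z hz1).deriv, ← sub_div]
    apply div_nonneg _ (sq_nonneg z)
    have := abs_le.1 (hw z hz1)
    rw [hFe z hz']
    nlinarith [this.1, this.2]

lemma aux_main (k M d : ℝ) (hk : 0 < k) (hM : 0 < M) (hd : 0 < d) (F g w : ℝ → ℝ)
    (hF : ∀ z > (0:ℝ), HasDerivAt F ((g z)^2) z)
    (hFe : ∀ z > (0:ℝ), F z = z * (g z)^2 + k * w z)
    (hg0 : ∀ z > (0:ℝ), 0 ≤ g z) (hgM : ∀ z > (0:ℝ), g z ≤ M)
    (hw : ∀ z > (0:ℝ), |w z| ≤ M * g z) (hFd : 0 < F d) :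
    ∃ c > (0:ℝ), Tendsto g atTop (nhds c) := by
  have hkw : ∀ z > (0:ℝ), |k * w z| ≤ k * (M * M) := by
    intro z hz
    rw [abs_mul, abs_of_pos hk]
    have h1 := hw z hz
    have h2 := hgM z hz
    have h3 : M * g z ≤ M * M := by gcongr
    have : |w z| ≤ M * M := h1.trans h3
    gcongr
  set e := k * (M * M) with he
  have he0 : 0 < e := by positivity
  have hinv : ∀ C : ℝ, Tendsto (fun z : ℝ => C / z) atTop (nhds 0) := fun C =>
    tendsto_const_nhds.div_atTop tendsto_id
  have hmono := aux_mono k F g w hF hFe e 1 one_pos (fun z hz => hkw z (by linarith))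
  have hex : ∃ L, Tendsto (fun z => F z / z - e / z) atTop (nhds L) := by
    set f := fun z => F z / z - e / z with hf
    have hm : Monotone (fun z => f (max z 1)) := by
      intro x y hxy
      exact hmono (mem_Ici.2 (le_max_right _ _)) (mem_Ici.2 (le_max_right _ _)) (max_le_max_right 1 hxy)
    have hb : BddAbove (range (fun z => f (max z 1))) := by
      refine ⟨M^2, ?_⟩
      rintro _ ⟨x, rfl⟩
      have hz : (0:ℝ) < max x 1 := lt_of_lt_of_le one_pos (le_max_right _ _)
      simp only [hf]
      generalize max x 1 = z at hz
      rw [← sub_div, div_le_iff₀ hz, hFe z hz]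
      have := (abs_le.1 (hkw z hz)).2
      have h4 : (g z)^2 ≤ M^2 := pow_le_pow_left₀ (hg0 z hz) (hgM z hz) 2
      nlinarith
    refine ⟨_, (tendsto_atTop_ciSup hm hb).congr' ?_⟩
    filter_upwards [eventually_ge_atTop 1] with z hz
    rw [max_eq_left hz]
  obtain ⟨L, hL⟩ := hex
  have hH : Tendsto (fun z => F z / z) atTop (nhds L) := by
    have := hL.add (hinv e)
    simpa using this
  have hwz : Tendsto (fun z => k * w z / z) atTop (nhds 0) := by
    apply squeeze_zero_norm' _ (hinv e)
    filter_upwards [eventually_gt_atTop 0] with z hz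
    rw [Real.norm_eq_abs, abs_div, abs_of_pos hz]
    have := hkw z hz
    gcongr
  have hg2 : Tendsto (fun z => (g z)^2) atTop (nhds L) := by
    have := hH.sub hwz
    rw [sub_zero] at this
    refine this.congr' ?_
    filter_upwards [eventually_gt_atTop 0] with z hz
    rw [hFe z hz]
    field_simp
    ring
  have hg : Tendsto g atTop (nhds (Real.sqrt L)) := by
    refine ((Real.continuous_sqrt.tendsto L).comp hg2).congr' ?_
    filter_upwards [eventually_gt_atTop 0] with z hz
    simp [Real.sqrt_sq (hg0 z hz)]
  have hL0 : 0 ≤ L := ge_of_tendsto hg2 (Eventually.of_forall fun z => sq_nonneg _)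
  rcases hL0.lt_or_eq with hLp | hLz
  · exact ⟨_, Real.sqrt_pos.2 hLp, hg⟩
  · exfalso
    subst hLz
    rw [Real.sqrt_zero] at hg
    have hkg : Tendsto (fun z => k * (M * g z)) atTop (nhds 0) := by
      simpa using (hg.const_mul M).const_mul k
    have hev := (hkg.eventually (gt_mem_nhds (half_pos hFd))).and (eventually_ge_atTop d)
    obtain ⟨z0, hz0⟩ := eventually_atTop.1 hev
    have hz0d : d ≤ z0 := (hz0 z0 le_rfl).2
    have hz0p : 0 < z0 := by linarith
    have hm2 := aux_mono k F g w hF hFe (F d / 2) z0 hz0p (by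
      intro z hz
      have hzp : 0 < z := by linarith
      rw [abs_mul, abs_of_pos hk]
      have := mul_le_mul_of_nonneg_left (hw z hzp) hk.le
      linarith [(hz0 z hz).1])
    have hlim : Tendsto (fun z => F z / z - F d / 2 / z) atTop (nhds 0) := by
      simpa using hH.sub (hinv (F d / 2))
    have hle : F z0 / z0 - F d / 2 / z0 ≤ 0 := by
      apply ge_of_tendsto hlim
      filter_upwards [eventually_ge_atTop z0] with z hz
      exact hm2 (mem_Ici.2 le_rfl) (mem_Ici.2 hz) hz
    rw [← sub_div, div_le_iff₀ hz0p, zero_mul] at hle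
    have hFm : MonotoneOn F (Ici d) := by
      apply monotoneOn_of_deriv_nonneg (convex_Ici d)
      · exact fun z hz => (hF z (lt_of_lt_of_le hd hz)).continuousAt.continuousWithinAt
      · intro z hz
        rw [interior_Ici] at hz
        exact (hF z (hd.trans hz)).differentiableAt.differentiableWithinAt
      · intro z hz
        rw [interior_Ici] at hz
        rw [(hF z (hd.trans hz)).deriv]
        positivity
    have := hFm (mem_Ici.2 le_rfl) (mem_Ici.2 hz0d) hz0d
    linarith

theorem stmt_19 (a Q₀ : ℝ) (ha : 0 < a) (hQ₀ : 0 < Q₀)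
    (Q Q' Q'' : ℝ → ℂ)
    (hd1 : ∀ ζ ≥ (0:ℝ), HasDerivAt Q (Q' ζ) ζ)
    (hd2 : ∀ ζ ≥ (0:ℝ), HasDerivAt Q' (Q'' ζ) ζ)
    (hcont : ContinuousOn Q'' (Set.Ici 0))
    (hode : ∀ ζ > (0:ℝ), Q'' ζ + (2/(ζ:ℂ)) * Q' ζ - Q ζ
        + Complex.I * (a:ℂ) * (Q ζ + (ζ:ℂ) * Q' ζ) + Q ζ * (‖Q ζ‖:ℂ)^2 = 0)
    (hinit0 : Q 0 = (Q₀ : ℂ)) (hinit1 : Q' 0 = 0)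
    (hbound : ∃ M > 0, ∀ ζ ≥ (0:ℝ), ‖(ζ:ℂ) * Q ζ‖ ≤ M ∧ ‖(ζ:ℂ) * Q' ζ‖ ≤ M)
    :
    ∃ c > (0:ℝ), Tendsto (fun ζ => ζ * ‖Q ζ‖) atTop (nhds c) := by
  obtain ⟨M, hM, hb⟩ := hbound
  set w : ℝ → ℝ := fun z => z^2 * ((Q' z).im * (Q z).re - (Q' z).re * (Q z).im) with hw
  set F : ℝ → ℝ := fun z => z^3 * ((Q z).re^2 + (Q z).im^2) + 2 / a * w z with hFdef
  have hn : ∀ z, ‖Q z‖^2 = (Q z).re^2 + (Q z).im^2 := by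
    intro z
    rw [Complex.sq_norm, Complex.normSq_apply]; ring
  have hre : ∀ (f : ℝ → ℂ) (f' : ℂ) (z : ℝ), HasDerivAt f f' z →
      HasDerivAt (fun z => (f z).re) f'.re z := fun f f' z h =>
    (Complex.reCLM.hasFDerivAt.comp_hasDerivAt z h)
  have him : ∀ (f : ℝ → ℂ) (f' : ℂ) (z : ℝ), HasDerivAt f f' z →
      HasDerivAt (fun z => (f z).im) f'.im z := fun f f' z h =>
    (Complex.imCLM.hasFDerivAt.comp_hasDerivAt z h)
  have hF0 : ∀ z ≥ (0:ℝ), HasDerivAt F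
      ((3 * z^2 * ((Q z).re^2 + (Q z).im^2) + z^3 * (2 * (Q z).re * (Q' z).re + 2 * (Q z).im * (Q' z).im))
        + 2 / a * (2 * z * ((Q' z).im * (Q z).re - (Q' z).re * (Q z).im)
          + z^2 * (((Q'' z).im * (Q z).re + (Q' z).im * (Q' z).re)
            - ((Q'' z).re * (Q z).im + (Q' z).re * (Q' z).im)))) z := by
    intro z hz
    have r1 := hre _ _ _ (hd1 z hz)
    have i1 := him _ _ _ (hd1 z hz)
    have r2 := hre _ _ _ (hd2 z hz)
    have i2 := him _ _ _ (hd2 z hz)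
    have h := (((hasDerivAt_pow 3 z).mul ((r1.pow 2).add (i1.pow 2))).add
      (((hasDerivAt_pow 2 z).mul ((i2.mul r1).sub (r2.mul i1))).const_mul (2/a)))
    refine h.congr_deriv ?_
    simp
  have hF : ∀ z > (0:ℝ), HasDerivAt F ((z * ‖Q z‖)^2) z := by
    intro z hz
    refine (hF0 z hz.le).congr_deriv ?_
    have ho := hode z hz
    have e2 : (2 / (z:ℂ)) = ((2 / z : ℝ) : ℂ) := by push_cast; rfl
    rw [e2, ← Complex.ofReal_pow] at ho
    have h1 := congrArg Complex.re ho
    have h2 := congrArg Complex.im ho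
    simp only [Complex.add_re, Complex.sub_re, Complex.mul_re, Complex.mul_im, Complex.add_im,
      Complex.sub_im, Complex.I_re, Complex.I_im, Complex.ofReal_re, Complex.ofReal_im,
      Complex.zero_re, Complex.zero_im] at h1 h2
    rw [mul_pow, hn z]
    generalize ‖Q z‖^2 = r at h1 h2
    have e1 : (Q'' z).re = -(2 / z * (Q' z).re) + (Q z).re + a * ((Q z).im + z * (Q' z).im)
        - (Q z).re * r := by linarith
    have e3 : (Q'' z).im = -(2 / z * (Q' z).im) + (Q z).im - a * ((Q z).re + z * (Q' z).re)
        - (Q z).im * r := by linarith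
    rw [e1, e3]
    field_simp
    ring
  have hdex : ∃ d > 0, 0 < F d := by
    have hc : ContinuousAt Q 0 := (hd1 0 le_rfl).continuousAt
    have hne : ∀ᶠ z in nhds (0:ℝ), Q z ≠ 0 :=
      hc.eventually_ne (by rw [hinit0]; exact_mod_cast hQ₀.ne')
    obtain ⟨d, hd, hdb⟩ := Metric.eventually_nhds_iff.1 hne
    refine ⟨d, hd, ?_⟩
    have hs : StrictMonoOn F (Icc 0 d) := by
      apply strictMonoOn_of_deriv_pos (convex_Icc 0 d)
      · exact fun z hz => (hF0 z hz.1).continuousAt.continuousWithinAt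
      · intro z hz
        rw [interior_Icc] at hz
        rw [(hF z hz.1).deriv]
        have : Q z ≠ 0 := hdb (by rw [Real.dist_eq, sub_zero, abs_of_pos hz.1]; exact hz.2)
        have := norm_pos_iff.2 this
        have := hz.1
        positivity
    have := hs (left_mem_Icc.2 hd.le) (right_mem_Icc.2 hd.le) hd
    have h0 : F 0 = 0 := by simp [hFdef, hw]
    rwa [h0] at this
  obtain ⟨d, hd, hFd⟩ := hdex
  refine aux_main (2 / a) M d (by positivity) hM hd F _ w hF ?_ ?_ ?_ ?_ hFd
  · intro z hz
    simp only [hFdef]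
    rw [mul_pow, hn z]; ring
  · intro z hz; positivity
  · intro z hz
    have := (hb z hz.le).1
    rwa [norm_mul, Complex.norm_of_nonneg hz.le] at this
  · intro z hz
    have h2 := (hb z hz.le).2
    rw [norm_mul, Complex.norm_of_nonneg hz.le] at h2
    have h3 : |(Q' z).im * (Q z).re - (Q' z).re * (Q z).im| ≤ ‖Q' z‖ * ‖Q z‖ := by
      have := Complex.abs_im_le_norm (Q' z * (starRingEnd ℂ) (Q z))
      rw [norm_mul, Complex.norm_conj, Complex.mul_im, Complex.conj_re, Complex.conj_im] at this
      convert this using 2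
      ring
    simp only [hw]
    rw [abs_mul, abs_of_nonneg (sq_nonneg z)]
    calc z^2 * |(Q' z).im * (Q z).re - (Q' z).re * (Q z).im| ≤ z^2 * (‖Q' z‖ * ‖Q z‖) := by gcongr
      _ = (z * ‖Q' z‖) * (z * ‖Q z‖) := by ring
      _ ≤ M * (z * ‖Q z‖) := by gcongr
end
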